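/- arXiv:1908.11682 — 6 statements merged into one kernel-verified Lean document; each statement's English description precedes it below -/
import Mathlib

section
/- Let m ≥ 1 and let 𝒳 = (X_1, …, X_m) be a family of random variables X_i : Ω → A_i on a finite probability space (Ω, μ), each A_i a nonempty finite type. Then W(𝒳) = Σ_{i=1}^m H(X_i) − max_{1≤i≤m} H(X_i) holds if and only if there exists an index q ∈ {1,…,m} such that for every j ∈ {1,…,m} there is a function f_j : A_q → A_j with P(X_j = f_j(X_q)) = 1 (i.e., Σ_{ω : X_j(ω) = f_j(X_q(ω))} μ(ω) = 1). -/
open Real BigOperators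

/-- The distribution of a random variable `X : Ω → A` under the pmf `μ`:
`P(X = a) = Σ_{ω : X ω = a} μ ω`. -/
noncomputable def prob {Ω : Type} [Fintype Ω] (μ : Ω → ℝ) {A : Type} [DecidableEq A]
    (X : Ω → A) (a : A) : ℝ :=
  ∑ ω ∈ Finset.univ.filter (fun ω => X ω = a), μ ω

/-- Shannon entropy (natural logarithm, `0 · log 0 = 0`) of a random variable. -/
noncomputable def entropy {Ω : Type} [Fintype Ω] (μ : Ω → ℝ) {A : Type} [Fintype A]
    [DecidableEq A] (X : Ω → A) : ℝ :=
  -∑ a : A, prob μ X a * Real.log (prob μ X a)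

/-- Joint entropy of a family of random variables: the entropy of the tuple-valued
random variable `ω ↦ (X 1 ω, …, X m ω)`. -/
noncomputable def jointEntropy {Ω : Type} [Fintype Ω] (μ : Ω → ℝ) {m : ℕ}
    {A : Fin m → Type} [∀ i, Fintype (A i)] [∀ i, DecidableEq (A i)]
    (X : ∀ i, Ω → A i) : ℝ :=
  entropy μ (fun ω => (fun i => X i ω : ∀ i, A i))

/-- Total correlation `W(𝒳) = Σ_i H(X_i) − H(X_1, …, X_m)`. -/
noncomputable def totalCorr {Ω : Type} [Fintype Ω] (μ : Ω → ℝ) {m : ℕ}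
    {A : Fin m → Type} [∀ i, Fintype (A i)] [∀ i, DecidableEq (A i)]
    (X : ∀ i, Ω → A i) : ℝ :=
  (∑ i, entropy μ (X i)) - jointEntropy μ X


/-- Entropy as the expectation of the information content `-log P(X = X ω)`. -/
theorem entropy_eq_sum {Ω : Type} [Fintype Ω] (μ : Ω → ℝ) {A : Type} [Fintype A]
    [DecidableEq A] (X : Ω → A) :
    entropy μ X = ∑ ω, -(μ ω * Real.log (prob μ X (X ω))) := by
  unfold entropy
  rw [Finset.sum_neg_distrib, ← Finset.sum_fiberwise Finset.univ X]
  congr 1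
  refine Finset.sum_congr rfl fun a _ => ?_
  conv_lhs => enter [1]; unfold prob
  rw [Finset.sum_mul]
  refine Finset.sum_congr rfl fun ω hω => ?_
  rw [(Finset.mem_filter.mp hω).2]

theorem prob_apply_pos {Ω : Type} [Fintype Ω] {μ : Ω → ℝ} (hμ0 : ∀ ω, 0 ≤ μ ω)
    {A : Type} [DecidableEq A] (X : Ω → A) {ω : Ω} (hω : μ ω ≠ 0) :
    0 < prob μ X (X ω) :=
  Finset.sum_pos' (fun _ _ => hμ0 _) ⟨ω, by simp, lt_of_le_of_ne (hμ0 ω) hω.symm⟩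

section Comparison

variable {Ω : Type} [Fintype Ω] {μ : Ω → ℝ} {A B : Type} [DecidableEq A] [DecidableEq B]
  {X : Ω → A} {Z : Ω → B}

theorem prob_apply_le_of_factors (hμ0 : ∀ ω, 0 ≤ μ ω)
    (hXZ : ∀ ω ω', Z ω' = Z ω → X ω' = X ω) (ω : Ω) :
    prob μ Z (Z ω) ≤ prob μ X (X ω) :=
  Finset.sum_le_sum_of_subset_of_nonneg
    (Finset.monotone_filter_right _ fun ω' _ h => hXZ ω ω' h) fun _ _ _ => hμ0 _

theorem prob_apply_eq_iff_of_factors (hμ0 : ∀ ω, 0 ≤ μ ω)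
    (hXZ : ∀ ω ω', Z ω' = Z ω → X ω' = X ω) (ω : Ω) :
    prob μ Z (Z ω) = prob μ X (X ω) ↔ ∀ ω', μ ω' ≠ 0 → X ω' = X ω → Z ω' = Z ω := by
  unfold prob
  rw [Finset.sum_filter, Finset.sum_filter, Finset.sum_eq_sum_iff_of_le]
  · refine ⟨fun h ω' hω' hX => ?_, fun h ω' _ => ?_⟩
    · by_contra hZ
      have := h ω' (Finset.mem_univ _)
      rw [if_neg hZ, if_pos hX] at this
      exact hω' this.symm
    · have h1 := h ω'
      have h2 := hXZ ω ω'
      split_ifs <;> grind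
  · intro ω' _
    have h1 := hXZ ω ω'
    have h2 := hμ0 ω'
    split_ifs <;> grind

theorem neg_mul_log_prob_le_of_factors (hμ0 : ∀ ω, 0 ≤ μ ω)
    (hXZ : ∀ ω ω', Z ω' = Z ω → X ω' = X ω) (ω : Ω) :
    -(μ ω * Real.log (prob μ X (X ω))) ≤ -(μ ω * Real.log (prob μ Z (Z ω))) := by
  by_cases hω : μ ω = 0
  · simp [hω]
  · exact neg_le_neg (mul_le_mul_of_nonneg_left (Real.log_le_log (prob_apply_pos hμ0 Z hω)
      (prob_apply_le_of_factors hμ0 hXZ ω)) (hμ0 ω))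

variable [Fintype A] [Fintype B]

theorem entropy_le_of_factors (hμ0 : ∀ ω, 0 ≤ μ ω)
    (hXZ : ∀ ω ω', Z ω' = Z ω → X ω' = X ω) : entropy μ X ≤ entropy μ Z := by
  rw [entropy_eq_sum, entropy_eq_sum]
  exact Finset.sum_le_sum fun ω _ => neg_mul_log_prob_le_of_factors hμ0 hXZ ω

/-- If `X` is a function of `Z`, then `H(X) = H(Z)` exactly when `X` determines `Z` on the
support of `μ`. -/
theorem entropy_eq_iff_of_factors (hμ0 : ∀ ω, 0 ≤ μ ω)
    (hXZ : ∀ ω ω', Z ω' = Z ω → X ω' = X ω) :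
    entropy μ X = entropy μ Z ↔
      ∀ ω, μ ω ≠ 0 → ∀ ω', μ ω' ≠ 0 → X ω' = X ω → Z ω' = Z ω := by
  rw [entropy_eq_sum, entropy_eq_sum,
    Finset.sum_eq_sum_iff_of_le fun ω _ => neg_mul_log_prob_le_of_factors hμ0 hXZ ω]
  refine forall_congr' fun ω => ?_
  by_cases hω : μ ω = 0
  · simp [hω]
  · rw [← prob_apply_eq_iff_of_factors hμ0 hXZ ω]
    simp only [Finset.mem_univ, forall_const, neg_inj, mul_right_inj' hω, ne_eq, hω,
      not_false_eq_true]
    refine ⟨fun h => ?_, fun h => by rw [h]⟩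
    exact (Real.log_injOn_pos (prob_apply_pos hμ0 X hω) (prob_apply_pos hμ0 Z hω) h).symm

end Comparison

/-- An event has probability one exactly when it contains the support. -/
theorem sum_filter_eq_one_iff {Ω : Type} [Fintype Ω] {μ : Ω → ℝ} (hμ0 : ∀ ω, 0 ≤ μ ω)
    (hμ1 : ∑ ω, μ ω = 1) (p : Ω → Prop) [DecidablePred p] :
    ∑ ω ∈ Finset.univ.filter p, μ ω = 1 ↔ ∀ ω, μ ω ≠ 0 → p ω := by
  have hsum := Finset.sum_filter_add_sum_filter_not Finset.univ p μ
  have hzero := Finset.sum_eq_zero_iff_of_nonneg (s := Finset.univ.filter fun ω => ¬ p ω)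
    fun ω _ => hμ0 ω
  rw [hμ1] at hsum
  trans ∑ ω ∈ Finset.univ.filter (fun ω => ¬ p ω), μ ω = 0
  · constructor <;> intro h <;> linarith
  · rw [hzero]
    simp only [Finset.mem_filter, Finset.mem_univ, true_and]
    exact forall_congr' fun ω => not_imp_comm

/-- `Y` is almost surely a function of `X` exactly when `X` determines `Y` on the support. -/
theorem exists_sum_filter_eq_one_iff {Ω : Type} [Fintype Ω] {μ : Ω → ℝ} (hμ0 : ∀ ω, 0 ≤ μ ω)
    (hμ1 : ∑ ω, μ ω = 1) {A B : Type} [DecidableEq B] [Nonempty B] (X : Ω → A) (Y : Ω → B) :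
    (∃ f : A → B, ∑ ω ∈ Finset.univ.filter (fun ω => Y ω = f (X ω)), μ ω = 1) ↔
      ∀ ω, μ ω ≠ 0 → ∀ ω', μ ω' ≠ 0 → X ω' = X ω → Y ω' = Y ω := by
  simp only [sum_filter_eq_one_iff hμ0 hμ1]
  constructor
  · rintro ⟨f, hf⟩ ω hω ω' hω' h
    rw [hf ω hω, hf ω' hω', h]
  · intro h
    have key : ∀ a, ∃ b, ∀ ω, μ ω ≠ 0 → X ω = a → Y ω = b := by
      intro a
      by_cases ha : ∃ ω, μ ω ≠ 0 ∧ X ω = a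
      · obtain ⟨ω, hω, rfl⟩ := ha
        exact ⟨Y ω, h ω hω⟩
      · exact ⟨Classical.arbitrary B, fun ω hω hX => (ha ⟨ω, hω, hX⟩).elim⟩
    choose f hf using key
    exact ⟨f, fun ω hω => hf _ ω hω rfl⟩

/-- For a family `𝒳 = (X_1, …, X_m)`, `m ≥ 1`, of random variables on a
finite probability space, `W(𝒳) = Σ_i H(X_i) − max_i H(X_i)` holds if and only if there is an
index `q` such that every `X_j` is almost surely a function of `X_q`, i.e. for every `j` there
is `f_j : A_q → A_j` with `P(X_j = f_j(X_q)) = 1`. -/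
theorem totalCorr_eq_sum_entropy_sub_max_iff {Ω : Type} [Fintype Ω] [Nonempty Ω]
    (μ : Ω → ℝ) (hμ0 : ∀ ω, 0 ≤ μ ω) (hμ1 : ∑ ω, μ ω = 1)
    {m : ℕ} (hm : 1 ≤ m) {A : Fin m → Type}
    [∀ i, Fintype (A i)] [∀ i, DecidableEq (A i)] [∀ i, Nonempty (A i)]
    (X : ∀ i, Ω → A i) :
    totalCorr μ X = (∑ i, entropy μ (X i)) - ⨆ i, entropy μ (X i) ↔
      ∃ q : Fin m, ∀ j : Fin m, ∃ f : A q → A j,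
        ∑ ω ∈ Finset.univ.filter (fun ω => X j ω = f (X q ω)), μ ω = 1 := by
  have hXZ : ∀ q ω ω', (fun i => X i ω' : ∀ i, A i) = (fun i => X i ω) → X q ω' = X q ω :=
    fun q _ _ h => congrFun h q
  have hle : ∀ q, entropy μ (X q) ≤ jointEntropy μ X := fun q =>
    entropy_le_of_factors hμ0 (hXZ q)
  have hiff : ∀ q, entropy μ (X q) = jointEntropy μ X ↔ ∀ j : Fin m, ∃ f : A q → A j,
      ∑ ω ∈ Finset.univ.filter (fun ω => X j ω = f (X q ω)), μ ω = 1 := by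
    intro q
    simp only [exists_sum_filter_eq_one_iff hμ0 hμ1]
    refine (entropy_eq_iff_of_factors hμ0 (hXZ q)).trans ⟨?_, ?_⟩
    · exact fun h j ω hω ω' hω' hq => congrFun (h ω hω ω' hω' hq) j
    · exact fun h ω hω ω' hω' hq => funext fun j => h j ω hω ω' hω' hq
  have : Nonempty (Fin m) := ⟨⟨0, hm⟩⟩
  simp only [← hiff, totalCorr, sub_right_inj]
  constructor
  · intro h
    obtain ⟨q, hq⟩ := exists_eq_ciSup_of_finite (f := fun i => entropy μ (X i))
    exact ⟨q, hq.trans h.symm⟩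
  · rintro ⟨q, hq⟩
    refine le_antisymm ?_ (ciSup_le hle)
    exact hq ▸ le_ciSup (f := fun i => entropy μ (X i)) (Set.finite_range _).bddAbove q
end

section
/- Let n ≥ 2 be a natural number, let A and B be nonempty finite types with R = |A| and C = |B|, and let x : Fin n → A and y : Fin n → B be two samples. Then the expected empirical mutual information under the permutation model satisfies (1/n!) · Σ_{σ ∈ Perm(Fin n)} Î(x; y∘σ) ≤ log((n + R·C − R − C)/(n − 1)), where the sum ranges over all n! permutations σ of Fin n and log is the natural logarithm. -/
open Real BigOperators

/-- The empirical entropy of a sample `z : Fin n → C`: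
`Ĥ(z) = −Σ_{c∈C} (N_c/n)·log(N_c/n)` where `N_c = |{k : z k = c}|`
(natural logarithm, `0 · log 0 = 0`). -/
noncomputable def empEntropy {n : ℕ} {C : Type} [Fintype C] [DecidableEq C]
    (z : Fin n → C) : ℝ :=
  -∑ c : C, (((Finset.univ.filter (fun k => z k = c)).card : ℝ) / n) *
      Real.log (((Finset.univ.filter (fun k => z k = c)).card : ℝ) / n)

/-- The empirical mutual information `Î(x;y) = Ĥ(x) + Ĥ(y) − Ĥ(k ↦ (x k, y k))`. -/
noncomputable def empMutualInfo {n : ℕ} {A B : Type} [Fintype A] [DecidableEq A]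
    [Fintype B] [DecidableEq B] (x : Fin n → A) (y : Fin n → B) : ℝ :=
  empEntropy x + empEntropy y - empEntropy (fun k => (x k, y k))

open Finset in
/-- The empirical entropy as an average over sample positions. -/
theorem empEntropy_eq_sum_log {n : ℕ} {C : Type} [Fintype C] [DecidableEq C] (z : Fin n → C) :
    empEntropy z = -(1 / (n : ℝ)) * ∑ k, Real.log ((#{l | z l = z k} : ℝ) / n) := by
  unfold empEntropy
  rw [← Finset.sum_fiberwise (s := univ) z, neg_mul, Finset.mul_sum]
  congr 1
  refine Finset.sum_congr rfl fun c _ => ?_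
  rw [Finset.sum_congr rfl (g := fun _ => Real.log ((#{l | z l = c} : ℝ) / n))]
  · rw [Finset.sum_const, nsmul_eq_mul]
    ring
  · intro k hk
    rw [(Finset.mem_filter.mp hk).2]

open Finset in
/-- The kernel averaging over the fibre of `z` through `k`. -/
noncomputable def fiberWeight {n : ℕ} {C : Type} [DecidableEq C] (z : Fin n → C)
    (k l : Fin n) : ℝ :=
  if z l = z k then 1 / (#{m | z m = z k} : ℝ) else 0

open Finset in
theorem card_fiber_pos {n : ℕ} {C : Type} [DecidableEq C] (z : Fin n → C) (k : Fin n) :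
    (0 : ℝ) < #{m | z m = z k} :=
  Nat.cast_pos.mpr (Finset.card_pos.mpr ⟨k, by simp⟩)

open Finset in
theorem sum_fiberWeight {n : ℕ} {C : Type} [DecidableEq C] (z : Fin n → C) (k : Fin n) :
    ∑ l, fiberWeight z k l = 1 := by
  unfold fiberWeight
  rw [← Finset.sum_filter, Finset.sum_const, nsmul_eq_mul]
  exact mul_one_div_cancel (card_fiber_pos z k).ne'

open Finset in
theorem sum_fiberWeight_diag_le {n : ℕ} {C : Type} [Fintype C] [DecidableEq C] (z : Fin n → C) :
    ∑ k, fiberWeight z k k ≤ Fintype.card C := by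
  rw [← Finset.sum_fiberwise (s := univ) z]
  calc _ ≤ ∑ _c : C, (1 : ℝ) := ?_
    _ = Fintype.card C := by simp
  refine Finset.sum_le_sum fun c _ => ?_
  rw [Finset.sum_congr rfl (g := fun _ => 1 / (#{l | z l = c} : ℝ))]
  · rw [Finset.sum_const, nsmul_eq_mul, mul_one_div]
    exact div_self_le_one _
  · intro k hk
    simp [fiberWeight, (Finset.mem_filter.mp hk).2]

open Finset in
theorem one_le_sum_fiberWeight_diag {n : ℕ} (hn : n ≠ 0) {C : Type} [DecidableEq C]
    (z : Fin n → C) : 1 ≤ ∑ k, fiberWeight z k k := by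
  have hn' : (n : ℝ) ≠ 0 := Nat.cast_ne_zero.mpr hn
  calc (1 : ℝ) = ∑ _k : Fin n, 1 / (n : ℝ) := by simp [hn']
    _ ≤ _ := ?_
  refine Finset.sum_le_sum fun k _ => ?_
  rw [fiberWeight, if_pos rfl]
  refine one_div_le_one_div_of_le (card_fiber_pos z k) ?_
  exact_mod_cast (Finset.card_le_univ _).trans_eq (Fintype.card_fin n)

theorem fiberWeight_comp {n : ℕ} {C : Type} [DecidableEq C] (z : Fin n → C)
    (σ : Equiv.Perm (Fin n)) (k l : Fin n) :
    fiberWeight (z ∘ σ) k l = fiberWeight z (σ k) (σ l) := by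
  have h : Finset.card {m | z (σ m) = z (σ k)} = Finset.card {m | z m = z (σ k)} :=
    Finset.card_equiv σ fun m => by simp
  simp [fiberWeight, h]

/-- The tangent-line bound for `log` at `L`, applied to the empirical mutual information. -/
theorem empMutualInfo_le {n : ℕ} (hn : n ≠ 0) {A B : Type} [Fintype A] [DecidableEq A]
    [Fintype B] [DecidableEq B] (x : Fin n → A) (y : Fin n → B) {L : ℝ} (hL : 0 < L) :
    empMutualInfo x y ≤
      (∑ k, ∑ l, fiberWeight x k l * fiberWeight y k l) / L - 1 + Real.log L := by
  have hn' : (0 : ℝ) < n := Nat.cast_pos.mpr (Nat.pos_of_ne_zero hn)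
  have hlog : ∀ t : ℝ, 0 < t → Real.log t ≤ t / L - 1 + Real.log L := fun t ht => by
    have h := Real.log_le_sub_one_of_pos (div_pos ht hL)
    rw [Real.log_div ht.ne' hL.ne'] at h
    linarith
  have key : empMutualInfo x y ≤ (1 / (n : ℝ)) *
      ∑ k, (n * (∑ l, fiberWeight x k l * fiberWeight y k l) / L - 1 + Real.log L) := by
    unfold empMutualInfo
    simp only [empEntropy_eq_sum_log]
    calc _ = (1 / (n : ℝ)) * (∑ k, (-Real.log ((Finset.card {l | x l = x k} : ℝ) / n) -
          Real.log ((Finset.card {l | y l = y k} : ℝ) / n) +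
          Real.log ((Finset.card {l | (x l, y l) = (x k, y k)} : ℝ) / n))) := by
          simp only [Finset.sum_add_distrib, Finset.sum_sub_distrib, Finset.sum_neg_distrib]
          ring
      _ ≤ _ := ?_
    refine mul_le_mul_of_nonneg_left (Finset.sum_le_sum fun k _ => ?_) (by positivity)
    have ha := card_fiber_pos x k
    have hb := card_fiber_pos y k
    have hc := card_fiber_pos (fun l => (x l, y l)) k
    have hsum : ∑ l, fiberWeight x k l * fiberWeight y k l =
        (Finset.card {l | (x l, y l) = (x k, y k)} : ℝ) /
          ((Finset.card {l | x l = x k} : ℝ) * (Finset.card {l | y l = y k} : ℝ)) := by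
      simp only [fiberWeight, ite_mul, mul_ite, zero_mul, mul_zero, ← ite_and, Prod.mk.injEq]
      rw [← Finset.sum_filter, Finset.sum_const, nsmul_eq_mul]
      simp only [and_comm]
      field_simp
    rw [hsum]
    refine le_trans (le_of_eq ?_) (hlog _ (by positivity))
    rw [Real.log_div ha.ne' hn'.ne', Real.log_div hb.ne' hn'.ne', Real.log_div hc.ne' hn'.ne',
      Real.log_mul hn'.ne' (by positivity), Real.log_div hc.ne' (by positivity),
      Real.log_mul ha.ne' hb.ne']
    ring
  refine key.trans (le_of_eq ?_)
  simp only [Finset.sum_add_distrib, Finset.sum_sub_distrib, ← Finset.sum_div, ← Finset.mul_sum,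
    Finset.sum_const, Finset.card_univ, Fintype.card_fin, nsmul_eq_mul]
  field_simp

theorem sum_perm_apply {n : ℕ} (g : Fin n → ℝ) (k : Fin n) :
    n * ∑ σ : Equiv.Perm (Fin n), g (σ k) = n.factorial * ∑ p, g p := by
  have hconst : ∀ k' : Fin n, ∑ σ : Equiv.Perm (Fin n), g (σ k') =
      ∑ σ : Equiv.Perm (Fin n), g (σ k) := fun k' => by
    rw [← Equiv.sum_comp (Equiv.mulRight (Equiv.swap k k')) fun σ => g (σ k')]
    simp
  calc _ = ∑ k' : Fin n, ∑ σ : Equiv.Perm (Fin n), g (σ k') := by simp [hconst]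
    _ = ∑ σ : Equiv.Perm (Fin n), ∑ p, g p := by
      rw [Finset.sum_comm]
      exact Finset.sum_congr rfl fun σ _ => Equiv.sum_comp σ g
    _ = _ := by simp [Fintype.card_perm]

theorem sum_perm_apply_pair {n : ℕ} (g : Fin n → Fin n → ℝ) {k l : Fin n} (hkl : k ≠ l) :
    n * ((n : ℝ) - 1) * ∑ σ : Equiv.Perm (Fin n), g (σ k) (σ l) =
      n.factorial * ((∑ p, ∑ q, g p q) - ∑ p, g p p) := by
  have hconst : ∀ k' l' : Fin n, k' ≠ l' → ∑ σ : Equiv.Perm (Fin n), g (σ k') (σ l') =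
      ∑ σ : Equiv.Perm (Fin n), g (σ k) (σ l) := fun k' l' h => by
    obtain ⟨τ, hk, hl⟩ := (MulAction.is_two_pretransitive_iff
      (G := Equiv.Perm (Fin n)) (α := Fin n)).mp
        (Equiv.Perm.isMultiplyPretransitive (Fin n) 2) h hkl
    rw [Equiv.Perm.smul_def] at hk hl
    rw [← Equiv.sum_comp (Equiv.mulRight τ) fun σ => g (σ k') (σ l')]
    simp [hk, hl]
  have hoff : ∀ h : Fin n → Fin n → ℝ,
      ∑ p, ∑ q ∈ Finset.univ.erase p, h p q = (∑ p, ∑ q, h p q) - ∑ p, h p p := fun h => by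
    rw [← Finset.sum_sub_distrib]
    exact Finset.sum_congr rfl fun p _ => Finset.sum_erase_eq_sub (Finset.mem_univ p)
  calc _ = ∑ k', ∑ l' ∈ Finset.univ.erase k', ∑ σ : Equiv.Perm (Fin n), g (σ k') (σ l') := by
        rw [Finset.sum_congr rfl fun k' _ => Finset.sum_congr rfl fun l' hl' =>
          hconst k' l' (Finset.ne_of_mem_erase hl').symm]
        have hn : 1 ≤ n := Nat.one_le_iff_ne_zero.mpr fun h => (h ▸ k).elim0
        simp [Nat.cast_sub hn, mul_assoc]
    _ = ∑ σ : Equiv.Perm (Fin n), ((∑ p, ∑ q, g p q) - ∑ p, g p p) := by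
      rw [hoff fun k' l' => ∑ σ : Equiv.Perm (Fin n), g (σ k') (σ l')]
      rw [Finset.sum_comm (γ := Fin n) (f := fun k' (σ : Equiv.Perm (Fin n)) => g (σ k') (σ k')),
        Finset.sum_congr rfl fun k' _ => Finset.sum_comm, Finset.sum_comm,
        ← Finset.sum_sub_distrib]
      refine Finset.sum_congr rfl fun σ _ => ?_
      rw [← Equiv.sum_comp σ fun p => g p p, ← Equiv.sum_comp σ fun p => ∑ q, g p q]
      exact congrArg (· - _) (Finset.sum_congr rfl fun p _ => Equiv.sum_comp σ (g (σ p)))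
    _ = _ := by simp [Fintype.card_perm, mul_sub]

/-- The average over all permutations `σ` of the pairing of `f` with `g` transported by `σ`
depends only on the total and diagonal sums of `f` and `g`. -/
theorem sum_perm_sum_mul {n : ℕ} (hn : 2 ≤ n) (f g : Fin n → Fin n → ℝ) :
    ∑ σ : Equiv.Perm (Fin n), ∑ k, ∑ l, f k l * g (σ k) (σ l) =
      n.factorial * ((∑ k, f k k) * (∑ k, g k k) / n +
        ((∑ k, ∑ l, f k l) - ∑ k, f k k) * ((∑ k, ∑ l, g k l) - ∑ k, g k k) /
          (n * ((n : ℝ) - 1))) := by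
  have hn2 : (2 : ℝ) ≤ n := by exact_mod_cast hn
  have h0 : (n : ℝ) ≠ 0 := by linarith
  have h1 : (n : ℝ) - 1 ≠ 0 := by linarith
  set D := n.factorial * (∑ p, g p p) / n with hD
  set T := n.factorial * ((∑ p, ∑ q, g p q) - ∑ p, g p p) / (n * ((n : ℝ) - 1)) with hT
  have hval : ∀ k l, ∑ σ : Equiv.Perm (Fin n), g (σ k) (σ l) = T + if l = k then D - T else 0 := by
    intro k l
    split_ifs with h
    · subst h
      rw [add_sub_cancel, hD, eq_div_iff h0, ← sum_perm_apply (fun p => g p p) l, mul_comm]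
    · rw [add_zero, hT, eq_div_iff (mul_ne_zero h0 h1), ← sum_perm_apply_pair g (Ne.symm h),
        mul_comm]
  calc _ = ∑ k, ∑ l, f k l * ∑ σ : Equiv.Perm (Fin n), g (σ k) (σ l) := by
        rw [Finset.sum_comm]
        simp only [Finset.mul_sum]
        exact Finset.sum_congr rfl fun k _ => Finset.sum_comm
    _ = (∑ k, ∑ l, f k l) * T + (∑ k, f k k) * (D - T) := by
        simp [hval, mul_add, Finset.sum_add_distrib, ← Finset.sum_mul]
    _ = _ := by
        rw [hD, hT]
        ring

/-- For samples `x : Fin n → A`, `y : Fin n → B` with `n ≥ 2`,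
`R = |A|`, `C = |B|`, the expected empirical mutual information under the permutation model
satisfies `(1/n!) Σ_{σ ∈ Perm(Fin n)} Î(x; y∘σ) ≤ log((n + R·C − R − C)/(n − 1))`. -/
theorem expected_empMutualInfo_le {n : ℕ} (hn : 2 ≤ n)
    {A B : Type} [Fintype A] [DecidableEq A] [Nonempty A]
    [Fintype B] [DecidableEq B] [Nonempty B]
    (x : Fin n → A) (y : Fin n → B) :
    (1 / (n.factorial : ℝ)) * ∑ σ : Equiv.Perm (Fin n), empMutualInfo x (y ∘ σ) ≤
      Real.log (((n : ℝ) + (Fintype.card A : ℝ) * (Fintype.card B : ℝ) -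
          (Fintype.card A : ℝ) - (Fintype.card B : ℝ)) / ((n : ℝ) - 1)) := by
  have hn2 : (2 : ℝ) ≤ n := by exact_mod_cast hn
  have hn0 : n ≠ 0 := by lia
  have h1 : (0 : ℝ) < (n : ℝ) - 1 := by linarith
  have hfac : (0 : ℝ) < n.factorial := Nat.cast_pos.mpr n.factorial_pos
  have hr := one_le_sum_fiberWeight_diag hn0 x
  have hs := one_le_sum_fiberWeight_diag hn0 y
  have hrR := sum_fiberWeight_diag_le x
  have hsC := sum_fiberWeight_diag_le y
  have havg := sum_perm_sum_mul hn (fiberWeight x) (fiberWeight y)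
  simp only [sum_fiberWeight, Finset.sum_const, Finset.card_univ, Fintype.card_fin,
    nsmul_eq_mul, mul_one] at havg
  set r := ∑ k, fiberWeight x k k
  set s := ∑ k, fiberWeight y k k
  set R := (Fintype.card A : ℝ)
  set C := (Fintype.card B : ℝ)
  set L := ((n : ℝ) + R * C - R - C) / ((n : ℝ) - 1) with hLdef
  have hmono : (r - 1) * (s - 1) ≤ (R - 1) * (C - 1) :=
    mul_le_mul (by linarith) (by linarith) (by linarith) (by linarith)
  have hL : 0 < L := by
    refine div_pos ?_ h1
    nlinarith [mul_nonneg (sub_nonneg.mpr hr) (sub_nonneg.mpr hs)]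
  have hS : r * s / n + ((n : ℝ) - r) * (n - s) / (n * ((n : ℝ) - 1)) ≤ L := by
    have h : r * s / n + ((n : ℝ) - r) * (n - s) / (n * ((n : ℝ) - 1)) =
        (n + r * s - r - s) / ((n : ℝ) - 1) := by
      field_simp
      ring
    rw [h, hLdef]
    exact div_le_div_of_nonneg_right (by linarith) h1.le
  calc _ ≤ (1 / (n.factorial : ℝ)) * ∑ σ : Equiv.Perm (Fin n),
        ((∑ k, ∑ l, fiberWeight x k l * fiberWeight y (σ k) (σ l)) / L - 1 + Real.log L) := by
        refine mul_le_mul_of_nonneg_left (Finset.sum_le_sum fun σ _ => ?_) (by positivity)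
        simpa only [fiberWeight_comp] using empMutualInfo_le hn0 x (y ∘ σ) hL
    _ = (r * s / n + ((n : ℝ) - r) * (n - s) / (n * ((n : ℝ) - 1))) / L - 1 + Real.log L := by
        simp only [Finset.sum_add_distrib, Finset.sum_sub_distrib, ← Finset.sum_div, havg,
          Finset.sum_const, Finset.card_univ, Fintype.card_perm, Fintype.card_fin, nsmul_eq_mul]
        field_simp
    _ ≤ Real.log L := by linarith [(div_le_one hL).mpr hS]
end

section
/- Let n, m be natural numbers with n ≥ 2 and m ≥ 1, let d : {1,…,m} → ℕ with d_i ≥ 1 for all i, and let D assign to every nonempty subset S ⊆ {1,…,m} a natural number with 1 ≤ D(S) ≤ Π_{i∈S} d_i. Then max_{σ ∈ S_m} Σ_{i=2}^m log((n + Π_{j=1}^i d_{σ(j)})/(n − 1)) ≥ max_{σ ∈ S_m} Σ_{i=2}^m log((n + D({σ(1),…,σ(i−1)})·d_{σ(i)} − D({σ(1),…,σ(i−1)}) − d_{σ(i)})/(n − 1)), where S_m denotes the set of permutations of {1,…,m}, the arithmetic inside the logarithms is carried out over the reals, and log is the natural logarithm. (Here d_i models the marginal domain size of the i-th variable and D(S)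 models the joint domain size of the variables indexed by S.) -/
open Real BigOperators

/-- Let `n ≥ 2`, `m ≥ 1`, let `d : Fin m → ℕ` be marginal domain sizes
(`d i ≥ 1`) and let `D` assign to every nonempty `S ⊆ Fin m` a joint domain size with
`1 ≤ D S ≤ Π_{i∈S} d i`.  Then
`max_σ Σ_{i=2}^m log((n + Π_{j=1}^i d_{σ(j)})/(n−1))
  ≥ max_σ Σ_{i=2}^m log((n + D({σ(1),…,σ(i−1)})·d_{σ(i)} − D({σ(1),…,σ(i−1)}) − d_{σ(i)})/(n−1))`.
(`0`-indexed below: the sums run over `i ≠ 0`, the prefix product over `j ≤ i`, and the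
strict prefix set is `σ '' {j : j < i}`; the maxima over permutations are written as `⨆`.) -/
theorem relaxed_correction_ge_correction (n m : ℕ) (hn : 2 ≤ n) (hm : 1 ≤ m)
    (d : Fin m → ℕ) (hd : ∀ i, 1 ≤ d i)
    (D : Finset (Fin m) → ℕ)
    (hD1 : ∀ S : Finset (Fin m), S.Nonempty → 1 ≤ D S)
    (hD2 : ∀ S : Finset (Fin m), S.Nonempty → D S ≤ ∏ i ∈ S, d i) :
    (⨆ σ : Equiv.Perm (Fin m),
        ∑ i ∈ Finset.univ.filter (fun i : Fin m => i.val ≠ 0),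
          Real.log (((n : ℝ) +
              ∏ j ∈ Finset.univ.filter (fun j : Fin m => j ≤ i), (d (σ j) : ℝ)) /
            ((n : ℝ) - 1))) ≥
      ⨆ σ : Equiv.Perm (Fin m),
        ∑ i ∈ Finset.univ.filter (fun i : Fin m => i.val ≠ 0),
          Real.log (((n : ℝ) +
              (D ((Finset.univ.filter (fun j : Fin m => j < i)).image σ) : ℝ) * (d (σ i) : ℝ) -
              (D ((Finset.univ.filter (fun j : Fin m => j < i)).image σ) : ℝ) - (d (σ i) : ℝ)) /
            ((n : ℝ) - 1)) := by
  refine ciSup_mono (Set.finite_range _).bddAbove fun σ => Finset.sum_le_sum fun i hi => ?_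
  set S := (Finset.univ.filter (fun j : Fin m => j < i)).image σ with hS
  have hne : S.Nonempty := by
    refine Finset.Nonempty.image ⟨⟨0, hm⟩, ?_⟩ σ
    exact Finset.mem_filter.2
      ⟨Finset.mem_univ _, Nat.pos_of_ne_zero (Finset.mem_filter.1 hi).2⟩
  have hprod : (∏ j ∈ Finset.univ.filter (fun j : Fin m => j ≤ i), (d (σ j) : ℝ)) =
      ((∏ k ∈ S, d k : ℕ) : ℝ) * d (σ i) := by
    have hins : Finset.univ.filter (fun j : Fin m => j ≤ i) =
        insert i (Finset.univ.filter (fun j : Fin m => j < i)) := by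
      ext j
      simp [le_iff_eq_or_lt]
    rw [hins, Finset.prod_insert (by simp), hS, Finset.prod_image σ.injective.injOn, mul_comm]
    push_cast
    rfl
  rw [hprod]
  have hn' : (2 : ℝ) ≤ n := by exact_mod_cast hn
  have hd' : (1 : ℝ) ≤ d (σ i) := by exact_mod_cast hd (σ i)
  have hD1' : (1 : ℝ) ≤ D S := by exact_mod_cast hD1 S hne
  have hD2' : (D S : ℝ) ≤ ((∏ k ∈ S, d k : ℕ) : ℝ) := by exact_mod_cast hD2 S hne
  have hmul := mul_le_mul_of_nonneg_right hD2' (zero_le_one.trans hd')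
  apply Real.log_le_log
  · apply div_pos <;> nlinarith [mul_nonneg (sub_nonneg.2 hD1') (sub_nonneg.2 hd')]
  · gcongr
    · linarith
    · linarith
end

section
/- Let n, m be natural numbers with n ≥ 2 and m ≥ 1, and let d : {1,…,m} → ℕ with d_i ≥ 1 for all i. If τ ∈ S_m is a permutation such that d_{τ(1)} ≥ d_{τ(2)} ≥ … ≥ d_{τ(m)}, then for every permutation σ ∈ S_m, Σ_{i=2}^m log((n + Π_{j=1}^i d_{τ(j)})/(n − 1)) ≥ Σ_{i=2}^m log((n + Π_{j=1}^i d_{σ(j)})/(n − 1)), where log is the natural logarithm; that is, the sum is maximized over S_m by any permutation ordering the values d_i in decreasing order. -/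
open Real BigOperators

/-- Products of an antitone `ℕ`-valued function over sets of the same size as an initial segment
are bounded by the product over that initial segment. -/
lemma prod_le_prod_Iic_of_card_eq {m : ℕ} {f : Fin m → ℕ} (hf : Antitone f) (i : Fin m)
    {t : Finset (Fin m)} (ht : t.card = (Finset.univ.filter (fun j : Fin m => j ≤ i)).card) :
    ∏ j ∈ t, f j ≤ ∏ j ∈ Finset.univ.filter (fun j : Fin m => j ≤ i), f j := by
  set s := Finset.univ.filter (fun j : Fin m => j ≤ i) with hs
  have hcard : (t \ s).card = (s \ t).card := by
    have h₁ := Finset.card_sdiff_add_card_inter t s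
    have h₂ := Finset.card_sdiff_add_card_inter s t
    rw [Finset.inter_comm] at h₂
    omega
  have hle : ∏ j ∈ t \ s, f j ≤ ∏ j ∈ s \ t, f j := calc
    ∏ j ∈ t \ s, f j ≤ ∏ _j ∈ t \ s, f i := Finset.prod_le_prod' fun j hj => hf <| by
      have hji : ¬ j ≤ i := by simpa [hs] using (Finset.mem_sdiff.mp hj).2
      exact (not_le.mp hji).le
    _ = ∏ _j ∈ s \ t, f i := by rw [Finset.prod_const, Finset.prod_const, hcard]
    _ ≤ ∏ j ∈ s \ t, f j := Finset.prod_le_prod' fun j hj => hf <| by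
      simpa [hs] using (Finset.mem_sdiff.mp hj).1
  rw [← Finset.prod_inter_mul_prod_sdiff t s, ← Finset.prod_inter_mul_prod_sdiff s t,
    Finset.inter_comm s t]
  exact Nat.mul_le_mul_left _ hle

/-- Let `n ≥ 2`, `m ≥ 1` and `d : Fin m → ℕ` with `d i ≥ 1`.
If `τ` sorts the values `d i` in decreasing order, then for every permutation `σ`,
`Σ_{i=2}^m log((n + Π_{j=1}^i d_{τ(j)})/(n−1)) ≥ Σ_{i=2}^m log((n + Π_{j=1}^i d_{σ(j)})/(n−1))`
(`0`-indexed below: sums over `i ≠ 0`, prefix products over `j ≤ i`). -/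
theorem decreasing_order_maximizes_correction (n m : ℕ) (hn : 2 ≤ n) (hm : 1 ≤ m)
    (d : Fin m → ℕ) (hd : ∀ i, 1 ≤ d i)
    (τ : Equiv.Perm (Fin m)) (hτ : ∀ i j : Fin m, i ≤ j → d (τ j) ≤ d (τ i)) :
    ∀ σ : Equiv.Perm (Fin m),
      ∑ i ∈ Finset.univ.filter (fun i : Fin m => i.val ≠ 0),
          Real.log (((n : ℝ) +
              ∏ j ∈ Finset.univ.filter (fun j : Fin m => j ≤ i), (d (τ j) : ℝ)) /
            ((n : ℝ) - 1)) ≥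
        ∑ i ∈ Finset.univ.filter (fun i : Fin m => i.val ≠ 0),
          Real.log (((n : ℝ) +
              ∏ j ∈ Finset.univ.filter (fun j : Fin m => j ≤ i), (d (σ j) : ℝ)) /
            ((n : ℝ) - 1)) := by
  intro σ
  have hn' : (0 : ℝ) < (n : ℝ) - 1 := by
    have : (2 : ℝ) ≤ n := by exact_mod_cast hn
    linarith
  refine Finset.sum_le_sum fun i _ => Real.log_le_log (by positivity) ?_
  gcongr ((n : ℝ) + ?_) / _
  have hf : Antitone (d ∘ τ) := fun i j h => hτ i j h
  have key := prod_le_prod_Iic_of_card_eq hf i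
    (Finset.card_map (σ.trans τ.symm).toEmbedding (s := Finset.univ.filter (· ≤ i)))
  rw [Finset.prod_map] at key
  simp only [Function.comp_apply, Equiv.coe_toEmbedding, Equiv.trans_apply,
    Equiv.apply_symm_apply] at key
  exact_mod_cast key
end

section
/- Let (Ω, μ) be a finite probability space, let n ≥ 2 be a natural number, let m ≥ 2 and q ≥ 1, and let X_1, …, X_m and Z_1, …, Z_q be random variables on Ω with X_i : Ω → A_i and Z_j : Ω → B_j, all codomains nonempty finite types. Assume W̄(X_1,…,X_m) > 0 and that for every j ∈ {1,…,q} one has H(Z_j) ≤ min_{1≤i≤m} H(X_i) (i.e., (X_1,…,X_m,Z_1,…,Z_q) is a low-entropy extension of (X_1,…,X_m)). Then t̄̄₀((X_1,…,X_m), n) ≤ t̄̄₀((X_1,…,X_m,Z_1,…,Z_q), n). -/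
open Real BigOperators

/-- The numerator of the correction term `t̄̄₀` for a family of `k` variables with domain
sizes `e : Fin k → ℕ` and sample size `n`:
`max_{σ ∈ S_k} Σ_{i=2}^k log((n + Π_{j=1}^i e_{σ(j)})/(n − 1))`
(`0`-indexed: sum over `i ≠ 0`, prefix product over `j ≤ i`). -/
noncomputable def tbbNum (n k : ℕ) (e : Fin k → ℕ) : ℝ :=
  ⨆ σ : Equiv.Perm (Fin k),
    ∑ i ∈ Finset.univ.filter (fun i : Fin k => i.val ≠ 0),
      Real.log (((n : ℝ) +
          ∏ j ∈ Finset.univ.filter (fun j : Fin k => j ≤ i), (e (σ j) : ℝ)) /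
        ((n : ℝ) - 1))

/-- The correction term `t̄̄₀(𝒳, n)` of a family of `k` variables, described by its domain
sizes `e : Fin k → ℕ` and marginal entropies `h : Fin k → ℝ`:
`t̄̄₀ = (max_σ Σ_{i=2}^k log((n + Π_{j=1}^i e_{σ(j)})/(n−1))) / W̄`,
where `W̄ = Σ_i h i − max_i h i`. -/
noncomputable def tbb (n k : ℕ) (e : Fin k → ℕ) (h : Fin k → ℝ) : ℝ :=
  tbbNum n k e / ((∑ i, h i) - ⨆ i, h i)

lemma prob_nonneg {Ω : Type} [Fintype Ω] {μ : Ω → ℝ} (hμ0 : ∀ ω, 0 ≤ μ ω)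
    {A : Type} [DecidableEq A] (X : Ω → A) (a : A) : 0 ≤ prob μ X a :=
  Finset.sum_nonneg fun ω _ => hμ0 ω

lemma prob_le_one {Ω : Type} [Fintype Ω] {μ : Ω → ℝ} (hμ0 : ∀ ω, 0 ≤ μ ω)
    (hμ1 : ∑ ω, μ ω = 1) {A : Type} [DecidableEq A] (X : Ω → A) (a : A) : prob μ X a ≤ 1 :=
  hμ1 ▸ Finset.sum_le_sum_of_subset_of_nonneg (Finset.filter_subset _ _) fun ω _ _ => hμ0 ω

lemma entropy_nonneg {Ω : Type} [Fintype Ω] {μ : Ω → ℝ} (hμ0 : ∀ ω, 0 ≤ μ ω)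
    (hμ1 : ∑ ω, μ ω = 1) {A : Type} [Fintype A] [DecidableEq A] (X : Ω → A) :
    0 ≤ entropy μ X :=
  neg_nonneg.2 <| Finset.sum_nonpos fun a _ =>
    Real.mul_log_nonpos (prob_nonneg hμ0 X a) (prob_le_one hμ0 hμ1 X a)

lemma log_add_div_sub_one_le_log {n x y : ℝ} (hn : 1 < n) (hx : 0 ≤ x) (hxy : x ≤ y) :
    Real.log ((n + x) / (n - 1)) ≤ Real.log ((n + y) / (n - 1)) := by
  have hn' : 0 < n - 1 := by linarith
  gcongr

lemma log_add_div_sub_one_nonneg {n x : ℝ} (hn : 1 < n) (hx : 0 ≤ x) :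
    0 ≤ Real.log ((n + x) / (n - 1)) := by
  refine Real.log_nonneg ?_
  rw [le_div_iff₀ (by linarith)]
  linarith

lemma prod_filter_natCast_le_prod {k : ℕ} {e : Fin k → ℕ} (he : ∀ i, 1 ≤ e i)
    (σ : Equiv.Perm (Fin k)) (p : Fin k → Prop) [DecidablePred p] :
    ∏ j ∈ Finset.univ.filter p, (e (σ j) : ℝ) ≤ ∏ j, (e j : ℝ) := by
  rw [← Equiv.prod_comp σ fun j => (e j : ℝ)]
  exact_mod_cast Finset.prod_le_prod_of_subset_of_one_le' (Finset.filter_subset _ _)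
    fun i _ _ => he (σ i)

/-- Every summand of `tbbNum` is at most the one with the full product of domain sizes. -/
lemma tbbNum_le {n k : ℕ} (hn : 2 ≤ n) (hk : 1 ≤ k) {e : Fin k → ℕ} (he : ∀ i, 1 ≤ e i) :
    tbbNum n k e ≤ ((k : ℝ) - 1) * Real.log (((n : ℝ) + ∏ j, (e j : ℝ)) / ((n : ℝ) - 1)) := by
  have hn' : (1 : ℝ) < n := by exact_mod_cast hn
  refine ciSup_le fun σ => ?_
  have hcard : ((Finset.univ.filter fun i : Fin k => i.val ≠ 0).card : ℝ) = (k : ℝ) - 1 := by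
    obtain ⟨k, rfl⟩ := Nat.exists_eq_add_of_le' hk
    have : (Finset.univ.filter fun i : Fin (k + 1) => i.val ≠ 0) = Finset.univ.erase 0 := by
      ext i
      rw [Finset.mem_filter, Finset.mem_erase, ne_eq, ne_eq, Fin.ext_iff, Fin.val_zero]
      exact and_comm
    rw [this, Finset.card_erase_of_mem (Finset.mem_univ _), Finset.card_fin]
    simp
  rw [← hcard, ← nsmul_eq_mul]
  refine Finset.sum_le_card_nsmul _ _ _ fun i _ => ?_
  exact log_add_div_sub_one_le_log hn' (Finset.prod_nonneg fun _ _ => Nat.cast_nonneg _)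
    (prod_filter_natCast_le_prod he σ _)

/-- Placing the new variables after an optimal ordering of the old ones adds `q` summands, each
at least the one with the full product of the old domain sizes. -/
lemma tbbNum_add_le_tbbNum_addCases {n m q : ℕ} (hn : 2 ≤ n) (hm : 1 ≤ m)
    (e : Fin m → ℕ) {f : Fin q → ℕ} (hf : ∀ j, 1 ≤ f j) :
    tbbNum n m e + q * Real.log (((n : ℝ) + ∏ j, (e j : ℝ)) / ((n : ℝ) - 1)) ≤
      tbbNum n (m + q) (Fin.addCases (motive := fun _ => ℕ) e f) := by
  have hn' : (1 : ℝ) < n := by exact_mod_cast hn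
  obtain ⟨σ, hσ⟩ := exists_eq_ciSup_of_finite (f := fun σ : Equiv.Perm (Fin m) =>
    ∑ i ∈ Finset.univ.filter (fun i : Fin m => i.val ≠ 0),
      Real.log (((n : ℝ) +
          ∏ j ∈ Finset.univ.filter (fun j : Fin m => j ≤ i), (e (σ j) : ℝ)) /
        ((n : ℝ) - 1)))
  let τ : Equiv.Perm (Fin (m + q)) :=
    finSumFinEquiv.permCongr (Equiv.sumCongr σ (Equiv.refl _))
  have hτl (i : Fin m) : τ (Fin.castAdd q i) = Fin.castAdd q (σ i) := by
    simp [τ, Equiv.permCongr_apply]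
  have hτr (j : Fin q) : τ (Fin.natAdd m j) = Fin.natAdd m j := by
    simp [τ, Equiv.permCongr_apply]
  unfold tbbNum
  rw [← hσ]
  refine le_trans ?_ (le_ciSup (Set.finite_range _).bddAbove τ)
  have hne (j : Fin q) : m + j.val ≠ 0 := by omega
  have hcast (i j : Fin m) : Fin.castAdd q i ≤ Fin.castAdd q j ↔ i ≤ j := Iff.rfl
  have hle (i : Fin m) (j : Fin q) : ¬ Fin.natAdd m j ≤ Fin.castAdd q i := by
    simp only [Fin.le_def, Fin.val_natAdd, Fin.val_castAdd]
    omega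
  have hle' (i : Fin m) (j : Fin q) : Fin.castAdd q i ≤ Fin.natAdd m j := by
    simp only [Fin.le_def, Fin.val_natAdd, Fin.val_castAdd]
    omega
  simp only [Finset.sum_filter, Finset.prod_filter, Fin.sum_univ_add, Fin.prod_univ_add, hτl, hτr,
    Fin.addCases_left, Fin.addCases_right, Fin.val_castAdd, Fin.val_natAdd, hle, hle', hne,
    if_true, if_false, Finset.prod_const_one, mul_one, hcast, ne_eq,
    not_false_eq_true]
  gcongr ?_ + ?_
  · exact le_rfl
  · rw [← nsmul_eq_mul]
    conv_lhs => rw [← Finset.card_fin q]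
    refine Finset.card_nsmul_le_sum _ _ _ fun j _ => ?_
    refine log_add_div_sub_one_le_log hn' (Finset.prod_nonneg fun _ _ => Nat.cast_nonneg _) ?_
    rw [Equiv.prod_comp σ fun i => (e i : ℝ)]
    refine le_mul_of_one_le_right (Finset.prod_nonneg fun _ _ => Nat.cast_nonneg _) ?_
    rw [← Finset.prod_filter]
    exact_mod_cast Finset.one_le_prod' fun j _ => hf j

lemma ciSup_addCases_of_le {m q : ℕ} (hm : 1 ≤ m) (h : Fin m → ℝ) (g : Fin q → ℝ)
    (hgh : ∀ j i, g j ≤ h i) :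
    ⨆ i, (Fin.addCases (motive := fun _ => ℝ) h g : Fin (m + q) → ℝ) i = ⨆ i, h i := by
  have : Nonempty (Fin m) := ⟨⟨0, hm⟩⟩
  have : Nonempty (Fin (m + q)) := ⟨⟨0, by omega⟩⟩
  refine le_antisymm (ciSup_le fun i => ?_) (ciSup_le fun i => ?_)
  · refine Fin.addCases (fun i => ?_) (fun j => ?_) i
    · rw [Fin.addCases_left]
      exact le_ciSup (Set.finite_range h).bddAbove i
    · rw [Fin.addCases_right]
      exact (hgh j ⟨0, hm⟩).trans (le_ciSup (Set.finite_range h).bddAbove _)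
  · refine le_of_eq_of_le ?_ (le_ciSup (Set.finite_range _).bddAbove (Fin.castAdd q i))
    rw [Fin.addCases_left]

lemma sub_one_mul_le_sum_sub_ciSup {m : ℕ} (hm : 1 ≤ m) {h : Fin m → ℝ} {c : ℝ}
    (hc : ∀ i, c ≤ h i) : ((m : ℝ) - 1) * c ≤ (∑ i, h i) - ⨆ i, h i := by
  have : Nonempty (Fin m) := ⟨⟨0, hm⟩⟩
  obtain ⟨i, hi⟩ := exists_eq_ciSup_of_finite (f := h)
  rw [← hi, ← Finset.add_sum_erase _ h (Finset.mem_univ i), add_sub_cancel_left]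
  have := Finset.card_nsmul_le_sum (Finset.univ.erase i) h c fun j _ => hc j
  rwa [Finset.card_erase_of_mem (Finset.mem_univ i), Finset.card_fin, nsmul_eq_mul,
    Nat.cast_pred hm] at this

/-- The monotonicity of `tbb` under low-entropy extensions, for arbitrary domain sizes and
nonnegative entropies. -/
lemma tbb_le_tbb_addCases {n m q : ℕ} (hn : 2 ≤ n) (hm : 1 ≤ m)
    {e : Fin m → ℕ} (he : ∀ i, 1 ≤ e i) {f : Fin q → ℕ} (hf : ∀ j, 1 ≤ f j)
    {h : Fin m → ℝ} {g : Fin q → ℝ} (hg : ∀ j, 0 ≤ g j)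
    (hW : 0 < (∑ i, h i) - ⨆ i, h i) (hgh : ∀ j i, g j ≤ h i) :
    tbb n m e h ≤ tbb n (m + q) (Fin.addCases (motive := fun _ => ℕ) e f)
      (Fin.addCases (motive := fun _ => ℝ) h g) := by
  have hnum := tbbNum_le hn hm he
  have hext := tbbNum_add_le_tbbNum_addCases hn hm e hf
  have hL : 0 ≤ Real.log (((n : ℝ) + ∏ j, (e j : ℝ)) / ((n : ℝ) - 1)) :=
    log_add_div_sub_one_nonneg (by exact_mod_cast hn)
      (Finset.prod_nonneg fun _ _ => Nat.cast_nonneg _)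
  have hsum : ((m : ℝ) - 1) * ∑ j, g j ≤ q * ((∑ i, h i) - ⨆ i, h i) := by
    rw [Finset.mul_sum]
    refine (Finset.sum_le_card_nsmul _ _ _ fun j _ =>
      sub_one_mul_le_sum_sub_ciSup hm (hgh j)).trans_eq ?_
    simp
  have hS : 0 ≤ ∑ j, g j := Finset.sum_nonneg fun j _ => hg j
  unfold tbb
  simp only [ciSup_addCases_of_le hm h g hgh, Fin.sum_univ_add, Fin.addCases_left,
    Fin.addCases_right]
  rw [add_sub_right_comm]
  set W := (∑ i, h i) - ⨆ i, h i
  set L := Real.log (((n : ℝ) + ∏ j, (e j : ℝ)) / ((n : ℝ) - 1))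
  rw [div_le_div_iff₀ hW (by linarith)]
  calc tbbNum n m e * (W + ∑ j, g j)
      = tbbNum n m e * W + tbbNum n m e * ∑ j, g j := mul_add _ _ _
    _ ≤ tbbNum n m e * W + ((m : ℝ) - 1) * L * ∑ j, g j := by gcongr
    _ = tbbNum n m e * W + L * (((m : ℝ) - 1) * ∑ j, g j) := by ring
    _ ≤ tbbNum n m e * W + L * (q * W) := by gcongr
    _ = (tbbNum n m e + q * L) * W := by ring
    _ ≤ _ := by gcongr


/-- Let `X_1, …, X_m` (`m ≥ 2`) and `Z_1, …, Z_q` (`q ≥ 1`) be random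
variables on a finite probability space with `W̄(X_1,…,X_m) > 0`, and suppose each `Z_j`
satisfies `H(Z_j) ≤ min_i H(X_i)` (low-entropy extension).  Then for every `n ≥ 2`,
`t̄̄₀((X_1,…,X_m), n) ≤ t̄̄₀((X_1,…,X_m,Z_1,…,Z_q), n)`, where the extended family is
described by the concatenated domain sizes and marginal entropies. -/
theorem tbb_mono_low_entropy_extension {Ω : Type} [Fintype Ω] [Nonempty Ω]
    (μ : Ω → ℝ) (hμ0 : ∀ ω, 0 ≤ μ ω) (hμ1 : ∑ ω, μ ω = 1)
    (n : ℕ) (hn : 2 ≤ n) {m q : ℕ} (hm : 2 ≤ m) (hq : 1 ≤ q)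
    {A : Fin m → Type} [∀ i, Fintype (A i)] [∀ i, DecidableEq (A i)] [∀ i, Nonempty (A i)]
    {B : Fin q → Type} [∀ j, Fintype (B j)] [∀ j, DecidableEq (B j)] [∀ j, Nonempty (B j)]
    (X : ∀ i, Ω → A i) (Z : ∀ j, Ω → B j)
    (hW : 0 < (∑ i, entropy μ (X i)) - ⨆ i, entropy μ (X i))
    (hlow : ∀ (j : Fin q) (i : Fin m), entropy μ (Z j) ≤ entropy μ (X i)) :
    tbb n m (fun i => Fintype.card (A i)) (fun i => entropy μ (X i)) ≤
      tbb n (m + q)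
        (Fin.addCases (motive := fun _ => ℕ)
          (fun i => Fintype.card (A i)) (fun j => Fintype.card (B j)))
        (Fin.addCases (motive := fun _ => ℝ)
          (fun i => entropy μ (X i)) (fun j => entropy μ (Z j))) := by
  exact tbb_le_tbb_addCases hn (by omega) (fun _ => Fintype.card_pos) (fun _ => Fintype.card_pos)
    (fun j => entropy_nonneg hμ0 hμ1 (Z j)) hW hlow
end

section
/- Let (Ω, μ) be a finite probability space, let X_1, …, X_m (m ≥ 2) and Z_1, …, Z_q (q ≥ 1) be random variables on Ω with nonempty finite codomains, assume W̄(X_1,…,X_m) > 0, W̄(X_1,…,X_m,Z_1,…,Z_q) > 0, and H(Z_j) ≤ min_{1≤i≤m} H(X_i) for every j. Then W(X_1,…,X_m,Z_1,…,Z_q) / W̄(X_1,…,X_m,Z_1,…,Z_q) ≤ (W(X_1,…,X_m) + Σ_{j=1}^q H(Z_j)) / (W̄(X_1,…,X_m) + Σ_{j=1}^q H(Z_j)). -/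
open Real BigOperators

/-- Entropy as an average of the information content over the sample space. -/
theorem entropy_eq_neg_sum_mul_log {Ω : Type} [Fintype Ω] (μ : Ω → ℝ) {A : Type} [Fintype A]
    [DecidableEq A] (X : Ω → A) :
    entropy μ X = -∑ ω, μ ω * Real.log (prob μ X (X ω)) := by
  rw [entropy, ← Finset.sum_fiberwise Finset.univ X]
  congr 1
  refine Finset.sum_congr rfl fun a _ => ?_
  rw [prob, Finset.sum_mul]
  refine Finset.sum_congr rfl fun ω hω => ?_
  rw [(Finset.mem_filter.mp hω).2, prob]

/-- Entropy does not increase under a function of the random variable. -/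
theorem entropy_comp_le {Ω : Type} [Fintype Ω] {μ : Ω → ℝ} (hμ : ∀ ω, 0 ≤ μ ω)
    {A B : Type} [Fintype A] [DecidableEq A] [Fintype B] [DecidableEq B]
    (X : Ω → A) (f : A → B) :
    entropy μ (fun ω => f (X ω)) ≤ entropy μ X := by
  rw [entropy_eq_neg_sum_mul_log, entropy_eq_neg_sum_mul_log]
  refine neg_le_neg (Finset.sum_le_sum fun ω _ => ?_)
  rcases (hμ ω).eq_or_lt with h | h
  · simp [← h]
  have hpos : 0 < prob μ X (X ω) :=
    h.trans_le (Finset.single_le_sum (f := μ) (fun i _ => hμ i) (by simp))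
  have hle : prob μ X (X ω) ≤ prob μ (fun ω => f (X ω)) (f (X ω)) :=
    Finset.sum_le_sum_of_subset_of_nonneg
      (Finset.monotone_filter_right _ fun _ _ hi => congrArg f hi) fun i _ _ => hμ i
  exact mul_le_mul_of_nonneg_left (Real.log_le_log hpos hle) h.le

/-- The supremum of two finite families is that of the first if it dominates the second. -/
theorem ciSup_sumElim_eq_left {ι κ : Type} [Finite ι] [Finite κ] [Nonempty ι]
    {f : ι → ℝ} {g : κ → ℝ} (h : ∀ j i, g j ≤ f i) :
    ⨆ k : ι ⊕ κ, Sum.elim f g k = ⨆ i, f i := by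
  have hf : BddAbove (Set.range f) := (Set.finite_range f).bddAbove
  refine le_antisymm (ciSup_le ?_) (ciSup_le fun i => ?_)
  · rintro (i | j)
    · exact le_ciSup hf i
    · exact (h j (Classical.arbitrary ι)).trans (le_ciSup hf _)
  · exact le_ciSup (f := Sum.elim f g) (Set.finite_range _).bddAbove (Sum.inl i)

/-- Let `X_1, …, X_m` (`m ≥ 2`) and `Z_1, …, Z_q` (`q ≥ 1`) be random
variables on a finite probability space with `W̄(X_1,…,X_m) > 0`,
`W̄(X_1,…,X_m,Z_1,…,Z_q) > 0`, and `H(Z_j) ≤ min_i H(X_i)` for every `j`.  Then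
`W(X,Z)/W̄(X,Z) ≤ (W(X) + Σ_j H(Z_j)) / (W̄(X) + Σ_j H(Z_j))`.
Below, the extended family `(X_1,…,X_m,Z_1,…,Z_q)` has joint entropy given by the entropy
of the combined tuple `ω ↦ ((X_i ω)_i, (Z_j ω)_j)`, sum of marginal entropies
`Σ_i H(X_i) + Σ_j H(Z_j)`, and maximal marginal entropy `⨆ k : Fin m ⊕ Fin q, …`. -/
theorem normalized_totalCorr_extension_le {Ω : Type} [Fintype Ω] [Nonempty Ω]
    (μ : Ω → ℝ) (hμ0 : ∀ ω, 0 ≤ μ ω) (hμ1 : ∑ ω, μ ω = 1)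
    {m q : ℕ} (hm : 2 ≤ m) (hq : 1 ≤ q)
    {A : Fin m → Type} [∀ i, Fintype (A i)] [∀ i, DecidableEq (A i)] [∀ i, Nonempty (A i)]
    {B : Fin q → Type} [∀ j, Fintype (B j)] [∀ j, DecidableEq (B j)] [∀ j, Nonempty (B j)]
    (X : ∀ i, Ω → A i) (Z : ∀ j, Ω → B j)
    (hWX : 0 < (∑ i, entropy μ (X i)) - ⨆ i, entropy μ (X i))
    (hWXZ : 0 < ((∑ i, entropy μ (X i)) + ∑ j, entropy μ (Z j)) -
        ⨆ k : Fin m ⊕ Fin q, Sum.elim (fun i => entropy μ (X i)) (fun j => entropy μ (Z j)) k)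
    (hlow : ∀ (j : Fin q) (i : Fin m), entropy μ (Z j) ≤ entropy μ (X i)) :
    (((∑ i, entropy μ (X i)) + ∑ j, entropy μ (Z j)) -
        entropy μ (fun ω => ((fun i => X i ω : ∀ i, A i), (fun j => Z j ω : ∀ j, B j)))) /
      (((∑ i, entropy μ (X i)) + ∑ j, entropy μ (Z j)) -
        ⨆ k : Fin m ⊕ Fin q,
          Sum.elim (fun i => entropy μ (X i)) (fun j => entropy μ (Z j)) k) ≤
      (totalCorr μ X + ∑ j, entropy μ (Z j)) /
        (((∑ i, entropy μ (X i)) - ⨆ i, entropy μ (X i)) + ∑ j, entropy μ (Z j)) := by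
  have : Nonempty (Fin m) := ⟨⟨0, by omega⟩⟩
  rw [ciSup_sumElim_eq_left hlow] at hWXZ ⊢
  have hjoint := entropy_comp_le hμ0
    (fun ω => ((fun i => X i ω : ∀ i, A i), (fun j => Z j ω : ∀ j, B j))) Prod.fst
  rw [totalCorr, jointEntropy, sub_add_eq_add_sub, sub_add_eq_add_sub]
  exact div_le_div_of_nonneg_right (sub_le_sub_left hjoint _) hWXZ.le
end
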